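/- Let Ω = [0,1] × [0,1/2] be the lower half of the unit square. Then the expected squared L2-discrepancy of the two-point jittered sampling construction associated to Ω equals D(Ω) = 1/18 (≈ 0.0555). -/

import Mathlib

open MeasureTheory Set

noncomputable section

/-- The closed unit square `[0,1]²` in `ℝ × ℝ`. -/
def unitSq : Set (ℝ × ℝ) := Icc (0:ℝ) 1 ×ˢ Icc (0:ℝ) 1

/-- The anchored axis-parallel box `[0,x] × [0,y]`. -/
def box (x y : ℝ) : Set (ℝ × ℝ) := Icc (0:ℝ) x ×ˢ Icc (0:ℝ) y

/-- The uniform probability measure on a set `S ⊆ ℝ²`. -/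
def unif (S : Set (ℝ × ℝ)) : Measure (ℝ × ℝ) := (volume S)⁻¹ • volume.restrict S

/-- The number of the two points `p1`, `p2` lying in the box `[0,x] × [0,y]`. -/
def countIn (p1 p2 : ℝ × ℝ) (x y : ℝ) : ℝ :=
  (box x y).indicator (fun _ => (1:ℝ)) p1 + (box x y).indicator (fun _ => (1:ℝ)) p2

/-- The squared L2 discrepancy of the two-point multiset `{p1, p2}`. -/
def L2sq (p1 p2 : ℝ × ℝ) : ℝ :=
  ∫ x in (0:ℝ)..1, ∫ y in (0:ℝ)..1, |countIn p1 p2 x y / 2 - x * y| ^ 2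

/-- The joint law of the jittered pair `(p1, p2)`: `p1` uniform on `Ω`,
`p2` uniform on `[0,1]² \ Ω`, independent. -/
def jitter (Ω : Set (ℝ × ℝ)) : Measure ((ℝ × ℝ) × (ℝ × ℝ)) :=
  (unif Ω).prod (unif (unitSq \ Ω))

/-- The expected squared L2 discrepancy of the two-point jittered sampling
construction associated to `Ω`. -/
def Djit (Ω : Set (ℝ × ℝ)) : ℝ := ∫ q, L2sq q.1 q.2 ∂(jitter Ω)

/-- `f1 Ω x y` is the Lebesgue measure of `Ω ∩ ([0,x] × [0,y])`. -/
def f1 (Ω : Set (ℝ × ℝ)) (x y : ℝ) : ℝ := (volume (Ω ∩ box x y)).toReal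

/-- The hypograph of `g` within the unit square. -/
def hypo (g : ℝ → ℝ) : Set (ℝ × ℝ) := {q ∈ unitSq | q.2 ≤ g q.1}

/-- `g` is an admissible partitioning function for area `p`: it is monotonically
decreasing on `[0,1]`, maps `[0,1]` into `[0,1]`, its hypograph has Lebesgue
measure `p`, and its hypograph is symmetric about the diagonal `y = x` up to a
Lebesgue-null set. -/
def Admissible (p : ℝ) (g : ℝ → ℝ) : Prop :=
  AntitoneOn g (Icc (0:ℝ) 1) ∧ (∀ x ∈ Icc (0:ℝ) 1, g x ∈ Icc (0:ℝ) 1) ∧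
  volume (hypo g) = ENNReal.ofReal p ∧
  (∀ᵐ q ∂(volume.restrict unitSq), (q ∈ hypo g ↔ q.swap ∈ hypo g))

end
lemma measurableSet_box (x y : ℝ) : MeasurableSet (box x y) :=
  measurableSet_Icc.prod measurableSet_Icc

lemma measurable_indicator_box {α : Type*} [MeasurableSpace α] {p z : α → ℝ × ℝ}
    (hp : Measurable p) (hz : Measurable z) :
    Measurable fun w => (box (z w).1 (z w).2).indicator (fun _ => (1:ℝ)) (p w) := by
  have hs : MeasurableSet {w | p w ∈ box (z w).1 (z w).2} := by
    simp only [box, mem_prod, mem_Icc, ofPred_and]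
    exact ((measurableSet_le measurable_const hp.fst).inter
      (measurableSet_le hp.fst hz.fst)).inter
      ((measurableSet_le measurable_const hp.snd).inter (measurableSet_le hp.snd hz.snd))
  exact (measurable_const (a := (1:ℝ))).indicator hs

lemma measurable_discrepancy :
    Measurable fun w : ((ℝ × ℝ) × (ℝ × ℝ)) × (ℝ × ℝ) =>
      |countIn w.1.1 w.1.2 w.2.1 w.2.2 / 2 - w.2.1 * w.2.2| ^ 2 := by
  have h₁ := measurable_indicator_box (α := ((ℝ × ℝ) × (ℝ × ℝ)) × (ℝ × ℝ))
    (p := fun w => w.1.1) (z := fun w => w.2) (by fun_prop) (by fun_prop)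
  have h₂ := measurable_indicator_box (α := ((ℝ × ℝ) × (ℝ × ℝ)) × (ℝ × ℝ))
    (p := fun w => w.1.2) (z := fun w => w.2) (by fun_prop) (by fun_prop)
  have h : Measurable fun w : ((ℝ × ℝ) × (ℝ × ℝ)) × (ℝ × ℝ) =>
      (countIn w.1.1 w.1.2 w.2.1 w.2.2 / 2 - w.2.1 * w.2.2) ^ 2 :=
    (((h₁.add h₂).div_const 2).sub (by fun_prop)).pow_const 2
  simpa only [sq_abs] using h

lemma countIn_mem_Icc (p q : ℝ × ℝ) (x y : ℝ) : countIn p q x y ∈ Icc (0:ℝ) 2 := by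
  unfold countIn
  by_cases hp : p ∈ box x y <;> by_cases hq : q ∈ box x y <;> simp [hp, hq]; norm_num

lemma norm_discrepancy_le {p q : ℝ × ℝ} {x y : ℝ} (hx : x ∈ Ioc (0:ℝ) 1)
    (hy : y ∈ Ioc (0:ℝ) 1) : ‖|countIn p q x y / 2 - x * y| ^ 2‖ ≤ 1 := by
  obtain ⟨hc₀, hc₂⟩ := countIn_mem_Icc p q x y
  have hxy₀ : 0 ≤ x * y := mul_nonneg hx.1.le hy.1.le
  have hxy₁ : x * y ≤ 1 := mul_le_one₀ hx.2 hy.1.le hy.2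
  rw [norm_pow, Real.norm_eq_abs, abs_abs]
  exact pow_le_one₀ (abs_nonneg _) (abs_le.2 ⟨by linarith, by linarith⟩)

lemma integrable_discrepancy (μ : Measure ((ℝ × ℝ) × (ℝ × ℝ))) [IsFiniteMeasure μ] :
    Integrable (fun w : ((ℝ × ℝ) × (ℝ × ℝ)) × (ℝ × ℝ) =>
      |countIn w.1.1 w.1.2 w.2.1 w.2.2 / 2 - w.2.1 * w.2.2| ^ 2)
      (μ.prod (volume.restrict (Ioc (0:ℝ) 1 ×ˢ Ioc (0:ℝ) 1))) := by
  have : IsFiniteMeasure (volume.restrict (Ioc (0:ℝ) 1 ×ˢ Ioc (0:ℝ) 1)) :=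
    ⟨by simp [Measure.volume_eq_prod]⟩
  refine Integrable.of_bound measurable_discrepancy.aestronglyMeasurable 1 ?_
  have h : ∀ᵐ z ∂(volume.restrict (Ioc (0:ℝ) 1 ×ˢ Ioc (0:ℝ) 1)),
      z ∈ Ioc (0:ℝ) 1 ×ˢ Ioc (0:ℝ) 1 :=
    ae_restrict_mem (measurableSet_Ioc.prod measurableSet_Ioc)
  filter_upwards [Measure.quasiMeasurePreserving_snd.ae h] with w hw
  exact norm_discrepancy_le hw.1 hw.2

lemma L2sq_eq_setIntegral (p q : ℝ × ℝ) :
    L2sq p q = ∫ z in Ioc (0:ℝ) 1 ×ˢ Ioc (0:ℝ) 1,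
      |countIn p q z.1 z.2 / 2 - z.1 * z.2| ^ 2 := by
  have h : IntegrableOn (fun z : ℝ × ℝ => |countIn p q z.1 z.2 / 2 - z.1 * z.2| ^ 2)
      (Ioc (0:ℝ) 1 ×ˢ Ioc (0:ℝ) 1) := by
    refine Measure.integrableOn_of_bounded (M := 1) (by simp [Measure.volume_eq_prod])
      (measurable_discrepancy.comp (measurable_prodMk_left (x := (p, q)))).aestronglyMeasurable
      ?_
    filter_upwards [ae_restrict_mem (measurableSet_Ioc.prod measurableSet_Ioc)] with z hz
    exact norm_discrepancy_le hz.1 hz.2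
  rw [Measure.volume_eq_prod] at h ⊢
  rw [setIntegral_prod _ h]
  simp only [L2sq, intervalIntegral.integral_of_le zero_le_one]

lemma integral_discrepancy (μ ν : Measure (ℝ × ℝ)) [IsProbabilityMeasure μ]
    [IsProbabilityMeasure ν] (x y : ℝ) :
    ∫ q, |countIn q.1 q.2 x y / 2 - x * y| ^ 2 ∂(μ.prod ν) =
      (μ.real (box x y) + ν.real (box x y)) * (1 / 4 - x * y)
        + μ.real (box x y) * ν.real (box x y) / 2 + (x * y) ^ 2 := by
  set I : ℝ × ℝ → ℝ := (box x y).indicator fun _ => 1 with hI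
  have hIi : ∀ m : Measure (ℝ × ℝ), [IsProbabilityMeasure m] → Integrable I m := fun m _ =>
    (integrable_const 1).indicator (measurableSet_box x y)
  have hIm : ∀ m : Measure (ℝ × ℝ), ∫ p, I p ∂m = m.real (box x y) := fun m =>
    integral_indicator_one (measurableSet_box x y)
  have hsq : ∀ p, I p ^ 2 = I p := fun p => by
    by_cases hp : p ∈ box x y <;> simp [hI, hp]
  have hexp : ∀ q : (ℝ × ℝ) × (ℝ × ℝ), |countIn q.1 q.2 x y / 2 - x * y| ^ 2 =
      (1 / 4 - x * y) * I q.1 + (1 / 4 - x * y) * I q.2 + 1 / 2 * (I q.1 * I q.2)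
        + (x * y) ^ 2 := fun q => by
    rw [sq_abs, countIn, ← hI]
    linear_combination (1 / 4 : ℝ) * hsq q.1 + (1 / 4 : ℝ) * hsq q.2
  have h₁ : Integrable (fun q : (ℝ × ℝ) × (ℝ × ℝ) => (1 / 4 - x * y) * I q.1) (μ.prod ν) :=
    ((hIi μ).comp_fst ν).const_mul _
  have h₂ : Integrable (fun q : (ℝ × ℝ) × (ℝ × ℝ) => (1 / 4 - x * y) * I q.2) (μ.prod ν) :=
    ((hIi ν).comp_snd μ).const_mul _
  have h₃ : Integrable (fun q : (ℝ × ℝ) × (ℝ × ℝ) => 1 / 2 * (I q.1 * I q.2)) (μ.prod ν) :=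
    ((hIi μ).mul_prod (hIi ν)).const_mul _
  simp_rw [hexp]
  rw [integral_add (by exact (h₁.add h₂).add h₃) (integrable_const _),
    integral_add (by exact h₁.add h₂) h₃, integral_add h₁ h₂, integral_const_mul, integral_const_mul, integral_const_mul,
    integral_prod_mul, integral_fun_fst, integral_fun_snd, integral_const]
  simp only [hIm, probReal_univ, one_smul]
  ring

lemma integral_L2sq_prod (μ ν : Measure (ℝ × ℝ)) [IsProbabilityMeasure μ]
    [IsProbabilityMeasure ν] :
    ∫ q, L2sq q.1 q.2 ∂(μ.prod ν) = ∫ x in (0:ℝ)..1, ∫ y in (0:ℝ)..1,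
      ((μ.real (box x y) + ν.real (box x y)) * (1 / 4 - x * y)
        + μ.real (box x y) * ν.real (box x y) / 2 + (x * y) ^ 2) := by
  have h := integrable_discrepancy (μ.prod ν)
  have h' := h.integral_prod_right
  simp only [integral_discrepancy] at h'
  simp_rw [L2sq_eq_setIntegral]
  rw [integral_integral_swap h]
  simp only [integral_discrepancy]
  rw [Measure.volume_eq_prod] at h' ⊢
  rw [setIntegral_prod _ h']
  simp only [intervalIntegral.integral_of_le zero_le_one]

lemma isProbabilityMeasure_unif {S : Set (ℝ × ℝ)} (h₀ : volume S ≠ 0) (h : volume S ≠ ⊤) :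
    IsProbabilityMeasure (unif S) :=
  ⟨by simp [unif, ENNReal.inv_mul_cancel h₀ h]⟩

lemma unif_real_apply (S T : Set (ℝ × ℝ)) (hT : MeasurableSet T) :
    (unif S).real T = (volume.real S)⁻¹ * volume.real (T ∩ S) := by
  simp [unif, Measure.real, Measure.restrict_apply hT]

lemma unitSq_diff_lowerHalf :
    unitSq \ (Icc (0:ℝ) 1 ×ˢ Icc (0:ℝ) (1/2)) = Icc (0:ℝ) 1 ×ˢ Ioc (1/2 : ℝ) 1 := by
  ext ⟨a, b⟩
  simp only [unitSq, mem_sdiff, mem_prod, mem_Icc, mem_Ioc]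
  constructor
  · rintro ⟨⟨ha, hb⟩, h⟩
    exact ⟨ha, lt_of_not_ge fun hb' => h ⟨ha, hb.1, hb'⟩, hb.2⟩
  · rintro ⟨ha, hb, hb'⟩
    exact ⟨⟨ha, by linarith, hb'⟩, fun h => by linarith [h.2.2]⟩

lemma unif_lowerHalf_real_box {x y : ℝ} (hx : x ∈ Icc (0:ℝ) 1) (hy : 0 ≤ y) :
    (unif (Icc (0:ℝ) 1 ×ˢ Icc (0:ℝ) (1/2))).real (box x y) = 2 * x * min y (1/2) := by
  rw [unif_real_apply _ _ (measurableSet_box x y), box, prod_inter_prod, Icc_inter_Icc,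
    Icc_inter_Icc, Measure.volume_eq_prod, measureReal_prod_prod, measureReal_prod_prod]
  simp [Real.volume_real_Icc, hx.1, hx.2, hy]
  ring

lemma unif_upperHalf_real_box {x y : ℝ} (hx : x ∈ Icc (0:ℝ) 1) (hy : y ∈ Icc (0:ℝ) 1) :
    (unif (Icc (0:ℝ) 1 ×ˢ Ioc (1/2 : ℝ) 1)).real (box x y) = 2 * x * max (y - 1/2) 0 := by
  have h : Icc 0 y ∩ Ioc (1/2 : ℝ) 1 = Ioc (1/2) y := by
    ext t
    simp only [mem_inter_iff, mem_Icc, mem_Ioc]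
    exact ⟨fun h => ⟨h.2.1, h.1.2⟩, fun h => ⟨⟨by linarith, h.2⟩, h.1, h.2.trans hy.2⟩⟩
  rw [unif_real_apply _ _ (measurableSet_box x y), box, prod_inter_prod, Icc_inter_Icc, h,
    Measure.volume_eq_prod, measureReal_prod_prod, measureReal_prod_prod]
  simp [Real.volume_real_Icc, Real.volume_real_Ioc, hx.1, hx.2]
  norm_num
  ring

lemma integral_expected_discrepancy (x : ℝ) :
    ∫ y in (0:ℝ)..1, ((2 * x * min y (1/2) + 2 * x * max (y - 1/2) 0) * (1 / 4 - x * y)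
      + 2 * x * min y (1/2) * (2 * x * max (y - 1/2) 0) / 2 + (x * y) ^ 2) =
      x / 4 - 5 / 24 * x ^ 2 := by
  rw [← intervalIntegral.integral_add_adjacent_intervals (b := (1/2 : ℝ))
    (Continuous.intervalIntegrable (by fun_prop) _ _)
    (Continuous.intervalIntegrable (by fun_prop) _ _)]
  have h₁ : EqOn (fun y : ℝ =>
      (2 * x * min y (1/2) + 2 * x * max (y - 1/2) 0) * (1 / 4 - x * y)
      + 2 * x * min y (1/2) * (2 * x * max (y - 1/2) 0) / 2 + (x * y) ^ 2)
      (fun y => x / 2 * y - x ^ 2 * y ^ 2) (uIcc 0 (1/2)) := fun y hy => by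
    rw [uIcc_of_le (by norm_num)] at hy
    simp only [min_eq_left hy.2, max_eq_right (sub_nonpos.2 hy.2)]
    ring
  have h₂ : EqOn (fun y : ℝ =>
      (2 * x * min y (1/2) + 2 * x * max (y - 1/2) 0) * (1 / 4 - x * y)
      + 2 * x * min y (1/2) * (2 * x * max (y - 1/2) 0) / 2 + (x * y) ^ 2)
      (fun y => (x / 2 + x ^ 2) * y - x ^ 2 * y ^ 2 - x ^ 2 / 2) (uIcc (1/2) 1) :=
    fun y hy => by
    rw [uIcc_of_le (by norm_num)] at hy
    simp only [min_eq_right hy.1, max_eq_left (sub_nonneg.2 hy.1)]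
    ring
  rw [intervalIntegral.integral_congr h₁, intervalIntegral.integral_congr h₂,
    intervalIntegral.integral_sub, intervalIntegral.integral_sub, intervalIntegral.integral_sub]
  · rw [intervalIntegral.integral_const_mul, intervalIntegral.integral_const_mul,
      intervalIntegral.integral_const_mul, intervalIntegral.integral_const_mul, integral_id,
      integral_id, integral_pow, integral_pow, intervalIntegral.integral_const]
    norm_num
    ring
  all_goals exact Continuous.intervalIntegrable (by fun_prop) _ _

/-- For `Ω = [0,1] × [0,1/2]`, the expected squared
L2-discrepancy of the two-point jittered construction is `1/18`. -/
theorem jitter_lower_half :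
    Djit (Icc (0:ℝ) 1 ×ˢ Icc (0:ℝ) (1/2)) = 1/18 := by
  have hl : volume.real (Icc (0:ℝ) 1 ×ˢ Icc (0:ℝ) (1/2)) ≠ 0 := by
    rw [Measure.volume_eq_prod, measureReal_prod_prod]
    simp
  have hu : volume.real (Icc (0:ℝ) 1 ×ˢ Ioc (1/2 : ℝ) 1) ≠ 0 := by
    rw [Measure.volume_eq_prod, measureReal_prod_prod]
    norm_num [Real.volume_real_Ioc]
  have := isProbabilityMeasure_unif (ENNReal.toReal_ne_zero.1 hl).1 (ENNReal.toReal_ne_zero.1 hl).2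
  have := isProbabilityMeasure_unif (ENNReal.toReal_ne_zero.1 hu).1 (ENNReal.toReal_ne_zero.1 hu).2
  rw [Djit, jitter, unitSq_diff_lowerHalf, integral_L2sq_prod]
  rw [intervalIntegral.integral_congr (g := fun x => x / 4 - 5 / 24 * x ^ 2) fun x hx => ?_,
    intervalIntegral.integral_sub]
  · rw [intervalIntegral.integral_div, intervalIntegral.integral_const_mul, integral_id,
      integral_pow]
    norm_num
  · exact Continuous.intervalIntegrable (by fun_prop) _ _
  · exact Continuous.intervalIntegrable (by fun_prop) _ _
  · rw [uIcc_of_le zero_le_one] at hx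
    simp only [← integral_expected_discrepancy x]
    refine intervalIntegral.integral_congr fun y hy => ?_
    rw [uIcc_of_le zero_le_one] at hy
    simp only [unif_lowerHalf_real_box hx hy.1, unif_upperHalf_real_box hx hy]
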